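/- Let f_m^2 denote the number of permutations π ∈ S_m with θ²(π) = π. Then for all n > 9, f_n^2 ≥ f_{n−1}^2 + f_{n−2}^2 + 2·f_{n−4}^2 + 2·f_{n−9}^2. -/

import Mathlib

/-- The one-line word of the image of `π` under the fundamental bijection:
write `π` in standard cycle form (every cycle written with its largest element
first, cycles listed in increasing order of their largest elements) and erase
the parentheses.  The cycle maxima are exactly the `x` with `π^[k] x ≤ x` for
all `k`, and the cycle of `x` is `x, π x, π² x, …` up to the period of `x`. -/
noncomputable def fundWord {n : ℕ} (π : Equiv.Perm (Fin n)) : List (Fin n) :=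
  ((List.finRange n).filter fun x => (List.range n).all fun k => decide ((⇑π)^[k] x ≤ x)).flatMap
    fun x => (List.range (Function.minimalPeriod (⇑π) x)).map fun k => (⇑π)^[k] x

/-- The permutation whose one-line notation is the word `w`
(junk value if `w` is not the one-line notation of a permutation). -/
noncomputable def permOfWord {n : ℕ} (w : List (Fin n)) : Equiv.Perm (Fin n) :=
  Function.invFun (fun σ : Equiv.Perm (Fin n) => (List.finRange n).map ⇑σ) w

/-- The fundamental bijection `θ`. -/
noncomputable def theta {n : ℕ} (π : Equiv.Perm (Fin n)) : Equiv.Perm (Fin n) :=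
  permOfWord (fundWord π)

/-- `π` contains the pattern `σ`. -/
def Contains {k n : ℕ} (σ : Equiv.Perm (Fin k)) (π : Equiv.Perm (Fin n)) : Prop :=
  ∃ f : Fin k → Fin n, StrictMono f ∧ ∀ a b : Fin k, π (f a) < π (f b) ↔ σ a < σ b

/-- `π` avoids the pattern `σ`. -/
def Avoids {k n : ℕ} (π : Equiv.Perm (Fin n)) (σ : Equiv.Perm (Fin k)) : Prop :=
  ¬ Contains σ π

noncomputable def p123 : Equiv.Perm (Fin 3) := Equiv.ofBijective ![0, 1, 2] (by decide)
noncomputable def p132 : Equiv.Perm (Fin 3) := Equiv.ofBijective ![0, 2, 1] (by decide)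
noncomputable def p213 : Equiv.Perm (Fin 3) := Equiv.ofBijective ![1, 0, 2] (by decide)
noncomputable def p231 : Equiv.Perm (Fin 3) := Equiv.ofBijective ![1, 2, 0] (by decide)
noncomputable def p312 : Equiv.Perm (Fin 3) := Equiv.ofBijective ![2, 0, 1] (by decide)
noncomputable def p321 : Equiv.Perm (Fin 3) := Equiv.ofBijective ![2, 1, 0] (by decide)

/-- The direct sum `π ⊕ τ` of two permutations. -/
def directSum {n m : ℕ} (π : Equiv.Perm (Fin n)) (τ : Equiv.Perm (Fin m)) :
    Equiv.Perm (Fin (n + m)) :=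
  finSumFinEquiv.permCongr (Equiv.sumCongr π τ)

/-- A permutation is irreducible if it is not a direct sum of two nonempty permutations. -/
def IrreduciblePerm {n : ℕ} (π : Equiv.Perm (Fin n)) : Prop :=
  ¬ ∃ (a b : ℕ) (_ : 0 < a) (_ : 0 < b) (h : a + b = n)
      (σ : Equiv.Perm (Fin a)) (τ : Equiv.Perm (Fin b)),
      π = (finCongr h).permCongr (directSum σ τ)

/-- A permutation is cyclic if its cycle decomposition is a single cycle of full length,
i.e. it acts transitively. -/
def IsCyclicPerm {n : ℕ} (π : Equiv.Perm (Fin n)) : Prop :=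
  ∀ x y : Fin n, ∃ k : ℕ, (⇑π)^[k] x = y
/-- The number of permutations `π ∈ S_m` with `θ²(π) = π`. -/
noncomputable def fixedTwoCount (m : ℕ) : ℕ :=
  Nat.card {π : Equiv.Perm (Fin m) // theta (theta π) = π}

open Function in
theorem forall_mem_range_iterate_le_iff {n : ℕ} (π : Equiv.Perm (Fin n)) (x : Fin n) :
    (∀ k ∈ List.range n, (⇑π)^[k] x ≤ x) ↔ ∀ k, (⇑π)^[k] x ≤ x := by
  refine ⟨fun h k => ?_, fun h k _ => h k⟩
  rw [← iterate_mod_minimalPeriod_eq (f := ⇑π)]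
  refine h _ (List.mem_range.2 ((Nat.mod_lt _ ?_).trans_le ?_))
  · exact minimalPeriod_pos_of_mem_periodicPts (π.injective.mem_periodicPts x)
  · simpa using minimalPeriod_le_card (f := ⇑π) (x := x)

open Classical in
theorem fundWord_eq {n : ℕ} (π : Equiv.Perm (Fin n)) :
    fundWord π = ((List.finRange n).filter fun x => ∀ k, (⇑π)^[k] x ≤ x).flatMap
      fun x => (List.range (Function.minimalPeriod (⇑π) x)).map fun k => (⇑π)^[k] x := by
  unfold fundWord
  congr 1
  refine List.filter_congr fun x _ => ?_
  rw [Bool.eq_iff_iff, List.all_eq_true]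
  simpa using forall_mem_range_iterate_le_iff π x

theorem exists_iterate_add_eq {n : ℕ} (π : Equiv.Perm (Fin n)) (x : Fin n) (a : ℕ) :
    ∃ b, (⇑π)^[b + a] x = x := by
  obtain ⟨p, hp, hx⟩ := Function.mem_periodicPts.1 (π.injective.mem_periodicPts x)
  refine ⟨p * a - a, ?_⟩
  rw [Nat.sub_add_cancel (Nat.le_mul_of_pos_left a hp)]
  exact hx.mul_const a

theorem mem_fundWord {n : ℕ} (π : Equiv.Perm (Fin n)) (y : Fin n) : y ∈ fundWord π := by
  classical
  rw [fundWord_eq]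
  obtain ⟨x, ⟨a, rfl⟩, hmax⟩ := (Set.toFinite (Set.range fun k => (⇑π)^[k] y)).exists_maximal
    (Set.range_nonempty _)
  simp only [List.mem_flatMap, List.mem_filter, List.mem_finRange, true_and, List.mem_map,
    List.mem_range, decide_eq_true_eq]
  refine ⟨(⇑π)^[a] y, fun k => ?_, ?_⟩
  · rw [← Function.iterate_add_apply]
    exact (le_total _ _).elim id fun h => hmax ⟨k + a, rfl⟩ h
  · obtain ⟨b, hb⟩ := exists_iterate_add_eq π y a
    refine ⟨b % Function.minimalPeriod π ((⇑π)^[a] y), Nat.mod_lt _ ?_, ?_⟩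
    · exact Function.minimalPeriod_pos_of_mem_periodicPts (π.injective.mem_periodicPts _)
    · rw [Function.iterate_mod_minimalPeriod_eq, ← Function.iterate_add_apply, hb]

theorem le_of_iterate_eq_iterate {n : ℕ} (π : Equiv.Perm (Fin n)) {x y : Fin n} {a b : ℕ}
    (hy : ∀ k, (⇑π)^[k] y ≤ y) (h : (⇑π)^[a] x = (⇑π)^[b] y) : x ≤ y := by
  obtain ⟨c, hc⟩ := exists_iterate_add_eq π x a
  rw [← hc, Function.iterate_add_apply, h, ← Function.iterate_add_apply]
  exact hy _

theorem nodup_fundWord {n : ℕ} (π : Equiv.Perm (Fin n)) : (fundWord π).Nodup := by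
  classical
  rw [fundWord_eq, List.nodup_flatMap]
  refine ⟨fun x _ => ?_, ?_⟩
  · refine List.Nodup.map_on (fun a ha b hb h => ?_) List.nodup_range
    exact Function.iterate_injOn_Iio_minimalPeriod (List.mem_range.1 ha) (List.mem_range.1 hb) h
  · refine ((List.nodup_finRange n).filter _).pairwise_of_forall_ne fun x hx y hy hxy => ?_
    simp only [List.mem_filter, List.mem_finRange, true_and, decide_eq_true_eq] at hx hy
    intro z hzx hzy
    obtain ⟨a, -, ha⟩ := List.mem_map.1 hzx
    obtain ⟨b, -, hb⟩ := List.mem_map.1 hzy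
    exact hxy (le_antisymm (le_of_iterate_eq_iterate π hy (ha.trans hb.symm))
      (le_of_iterate_eq_iterate π hx (hb.trans ha.symm)))

theorem map_finRange_perm_injective (n : ℕ) :
    Function.Injective fun σ : Equiv.Perm (Fin n) => (List.finRange n).map ⇑σ := by
  intro σ τ h
  ext i
  have := List.map_inj_left.1 h i (List.mem_finRange i)
  rw [this]

theorem map_finRange_theta {n : ℕ} (π : Equiv.Perm (Fin n)) :
    (List.finRange n).map (theta π) = fundWord π := by
  refine Function.invFun_eq (f := fun σ : Equiv.Perm (Fin n) => (List.finRange n).map ⇑σ) ?_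
  let e := (nodup_fundWord π).getEquivOfForallMemList _ (mem_fundWord π)
  have hl : (fundWord π).length = n := by simpa using Fintype.card_congr e
  refine ⟨(finCongr hl.symm).trans e, List.ext_get (by simp [hl]) fun i h₁ h₂ => ?_⟩
  simp [e]

theorem theta_eq_iff {n : ℕ} {π σ : Equiv.Perm (Fin n)} :
    theta π = σ ↔ fundWord π = (List.finRange n).map σ := by
  rw [← map_finRange_theta, (map_finRange_perm_injective n).eq_iff]

theorem directSum_castAdd {m k : ℕ} (π : Equiv.Perm (Fin m)) (τ : Equiv.Perm (Fin k))
    (i : Fin m) : directSum π τ (Fin.castAdd k i) = Fin.castAdd k (π i) := by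
  simp [directSum, Equiv.permCongr_apply]

theorem directSum_natAdd {m k : ℕ} (π : Equiv.Perm (Fin m)) (τ : Equiv.Perm (Fin k))
    (i : Fin k) : directSum π τ (Fin.natAdd m i) = Fin.natAdd m (τ i) := by
  simp [directSum, Equiv.permCongr_apply]

theorem finRange_add (m k : ℕ) : List.finRange (m + k) =
    (List.finRange m).map (Fin.castAdd k) ++ (List.finRange k).map (Fin.natAdd m) := by
  simp only [← List.ofFn_id, List.ofFn_add, List.map_ofFn]
  rfl

theorem flatMap_filter_map_of_semiconj {m n : ℕ} {π : Equiv.Perm (Fin m)}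
    {σ : Equiv.Perm (Fin n)} {f : Fin m → Fin n} (hf : StrictMono f)
    (h : Function.Semiconj f π σ) (l : List (Fin m)) (p : Fin n → Prop) [DecidablePred p]
    (q : Fin m → Prop) [DecidablePred q] (hp : ∀ x, p x ↔ ∀ k, (⇑σ)^[k] x ≤ x)
    (hq : ∀ x, q x ↔ ∀ k, (⇑π)^[k] x ≤ x) :
    ((l.map f).filter p).flatMap
        (fun x => (List.range (Function.minimalPeriod (⇑σ) x)).map fun k => (⇑σ)^[k] x) =
      ((l.filter q).flatMap
        fun x => (List.range (Function.minimalPeriod (⇑π) x)).map fun k => (⇑π)^[k] x).map f := by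
  have hit (k x) : (⇑σ)^[k] (f x) = f ((⇑π)^[k] x) := ((h.iterate_right k) x).symm
  have hper (x) : Function.minimalPeriod σ (f x) = Function.minimalPeriod π x :=
    Function.minimalPeriod_eq_minimalPeriod_iff.2 fun k => by
      simp only [Function.IsPeriodicPt, Function.IsFixedPt, hit, hf.injective.eq_iff]
  have hpq (x) : p (f x) ↔ q x := by simp only [hp, hq, hit, hf.le_iff_le]
  rw [List.filter_map, List.flatMap_map, List.map_flatMap]
  simp only [Function.comp_def, hpq, hper, hit, List.map_map]

theorem fundWord_directSum {m k : ℕ} (π : Equiv.Perm (Fin m)) (τ : Equiv.Perm (Fin k)) :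
    fundWord (directSum π τ) =
      (fundWord π).map (Fin.castAdd k) ++ (fundWord τ).map (Fin.natAdd m) := by
  classical
  rw [fundWord_eq, fundWord_eq, fundWord_eq, finRange_add, List.filter_append,
    List.flatMap_append,
    flatMap_filter_map_of_semiconj (Fin.strictMono_castAdd k)
      (fun x => (directSum_castAdd π τ x).symm) _ _ _ (fun _ => Iff.rfl) (fun _ => Iff.rfl),
    flatMap_filter_map_of_semiconj (Fin.strictMono_natAdd m)
      (fun x => (directSum_natAdd π τ x).symm) _ _ _ (fun _ => Iff.rfl) (fun _ => Iff.rfl)]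

theorem theta_directSum {m k : ℕ} (π : Equiv.Perm (Fin m)) (τ : Equiv.Perm (Fin k)) :
    theta (directSum π τ) = directSum (theta π) (theta τ) := by
  rw [theta_eq_iff, fundWord_directSum, ← map_finRange_theta, ← map_finRange_theta, finRange_add,
    List.map_append]
  simp [Function.comp_def, directSum_castAdd, directSum_natAdd]

theorem directSum_left_injective {m k : ℕ} (τ : Equiv.Perm (Fin k)) :
    Function.Injective fun π : Equiv.Perm (Fin m) => directSum π τ := by
  intro π σ h
  ext i
  have := congrArg (fun ρ : Equiv.Perm (Fin (m + k)) => (ρ (Fin.castAdd k i) : ℕ)) h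
  simpa [directSum_castAdd] using this

/-- The permutations fixed by `θ²` whose last value lies `d` below `n` (counting from `0`). -/
def FixedTwoWithLast (n d : ℕ) : Type :=
  {π : Equiv.Perm (Fin n) //
    theta (theta π) = π ∧ ∀ i : Fin n, (i : ℕ) + 1 = n → (π i : ℕ) + d = n}

theorem fixedTwoCount_le_card {n m k : ℕ} (τ : Equiv.Perm (Fin (k + 1)))
    (hτ : theta (theta τ) = τ) {d : ℕ} (hd : (τ (Fin.last k) : ℕ) + d = k + 1)
    (hn : m + (k + 1) = n) : fixedTwoCount m ≤ Nat.card (FixedTwoWithLast n d) := by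
  subst hn
  have : Finite (FixedTwoWithLast (m + (k + 1)) d) := Subtype.finite
  refine Nat.card_le_card_of_injective
    (fun π => (⟨directSum π.1 τ, by rw [theta_directSum, theta_directSum, π.2, hτ],
      fun i hi => ?_⟩ : FixedTwoWithLast (m + (k + 1)) d)) fun π σ h => ?_
  · obtain rfl : i = Fin.natAdd m (Fin.last k) := by ext; simp; omega
    rw [directSum_natAdd, Fin.val_natAdd]
    omega
  · exact Subtype.ext (directSum_left_injective τ (congrArg Subtype.val h))

theorem sum_card_fixedTwoWithLast_le {n : ℕ} (hn : 0 < n) (s : Finset ℕ) :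
    ∑ d ∈ s, Nat.card (FixedTwoWithLast n d) ≤ fixedTwoCount n := by
  have (d : ℕ) : Finite (FixedTwoWithLast n d) := Subtype.finite
  rw [← Finset.sum_coe_sort, ← Nat.card_sigma]
  refine Nat.card_le_card_of_injective
    (fun x => (⟨x.2.1, x.2.2.1⟩ : {π : Equiv.Perm (Fin n) // theta (theta π) = π})) ?_
  rintro ⟨⟨a, ha⟩, π, hπ, hπa⟩ ⟨⟨b, hb⟩, σ, hσ, hσb⟩ h
  obtain rfl : π = σ := congrArg Subtype.val h
  have h₁ := hπa ⟨n - 1, by omega⟩ (Nat.sub_add_cancel hn)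
  have h₂ := hσb ⟨n - 1, by omega⟩ (Nat.sub_add_cancel hn)
  obtain rfl : a = b := Nat.add_left_cancel (h₁.trans h₂.symm)
  rfl

theorem theta_eq_of_period {n : ℕ} {π σ : Equiv.Perm (Fin n)} (p : Fin n → ℕ)
    (hp : ∀ x, 0 < p x ∧ (⇑π)^[p x] x = x ∧ ∀ k < p x, 0 < k → (⇑π)^[k] x ≠ x)
    (h : (((List.finRange n).filter fun x =>
        (List.range n).all fun k => decide ((⇑π)^[k] x ≤ x)).flatMap
      fun x => (List.range (p x)).map fun k => (⇑π)^[k] x) = (List.finRange n).map σ) :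
    theta π = σ := by
  have hper (x) : Function.minimalPeriod π x = p x := by
    obtain ⟨h0, hx, hlt⟩ := hp x
    refine (Function.IsPeriodicPt.minimalPeriod_le h0 hx).antisymm (not_lt.1 fun hl => ?_)
    exact hlt _ hl (Function.IsPeriodicPt.minimalPeriod_pos h0 hx) Function.iterate_minimalPeriod
  rw [theta_eq_iff, ← h]
  simp only [fundWord, hper]

/-- The permutation `4213` (in one-line notation); `θ` exchanges it with `3421`. -/
def perm4213 : Equiv.Perm (Fin 4) := ⟨![3, 0, 2, 1], ![1, 3, 2, 0], by decide, by decide⟩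

/-- The permutation `3421` (in one-line notation). -/
def perm3421 : Equiv.Perm (Fin 4) := ⟨![2, 3, 1, 0], ![3, 2, 0, 1], by decide, by decide⟩

/-- The permutation `916823754` (in one-line notation); `θ` exchanges it with `637948521`. -/
def perm916823754 : Equiv.Perm (Fin 9) :=
  ⟨![8, 0, 5, 7, 1, 2, 6, 4, 3], ![1, 4, 5, 8, 7, 2, 6, 3, 0], by decide, by decide⟩

/-- The permutation `637948521` (in one-line notation). -/
def perm637948521 : Equiv.Perm (Fin 9) :=
  ⟨![5, 2, 6, 8, 3, 7, 4, 1, 0], ![8, 7, 1, 4, 6, 0, 2, 5, 3], by decide, by decide⟩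

theorem theta_one : theta (1 : Equiv.Perm (Fin 1)) = 1 := Subsingleton.elim _ _

theorem theta_swap : theta (Equiv.swap 0 1 : Equiv.Perm (Fin 2)) = Equiv.swap 0 1 :=
  theta_eq_of_period ![2, 2] (by decide) (by decide)

theorem theta_perm4213 : theta perm4213 = perm3421 :=
  theta_eq_of_period ![3, 3, 1, 3] (by decide) (by decide)

theorem theta_perm3421 : theta perm3421 = perm4213 :=
  theta_eq_of_period ![4, 4, 4, 4] (by decide) (by decide)

theorem theta_perm916823754 : theta perm916823754 = perm637948521 :=
  theta_eq_of_period ![6, 6, 2, 6, 6, 2, 1, 6, 6] (by decide) (by decide)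

theorem theta_perm637948521 : theta perm637948521 = perm916823754 :=
  theta_eq_of_period ![9, 9, 9, 9, 9, 9, 9, 9, 9] (by decide) (by decide)

/-- for `n > 9`,
`f_n^2 ≥ f_{n−1}^2 + f_{n−2}^2 + 2 f_{n−4}^2 + 2 f_{n−9}^2`. -/
theorem fixedTwoCount_lower_bound (n : ℕ) (hn : 9 < n) :
    fixedTwoCount (n - 1) + fixedTwoCount (n - 2) +
      2 * fixedTwoCount (n - 4) + 2 * fixedTwoCount (n - 9) ≤ fixedTwoCount n := by
  have h := sum_card_fixedTwoWithLast_le (show 0 < n by omega) {1, 2, 3, 4, 6, 9}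
  have h1 := fixedTwoCount_le_card (n := n) (m := n - 1) 1 (by rw [theta_one, theta_one])
    (d := 1) (by decide) (by omega)
  have h2 := fixedTwoCount_le_card (n := n) (m := n - 2) (Equiv.swap 0 1)
    (by rw [theta_swap, theta_swap]) (d := 2) (by decide) (by omega)
  have h3 := fixedTwoCount_le_card (n := n) (m := n - 4) perm4213
    (by rw [theta_perm4213, theta_perm3421]) (d := 3) (by decide) (by omega)
  have h4 := fixedTwoCount_le_card (n := n) (m := n - 4) perm3421
    (by rw [theta_perm3421, theta_perm4213]) (d := 4) (by decide) (by omega)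
  have h6 := fixedTwoCount_le_card (n := n) (m := n - 9) perm916823754
    (by rw [theta_perm916823754, theta_perm637948521]) (d := 6) (by decide) (by omega)
  have h9 := fixedTwoCount_le_card (n := n) (m := n - 9) perm637948521
    (by rw [theta_perm637948521, theta_perm916823754]) (d := 9) (by decide) (by omega)
  simp at h
  omega
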